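/- (Polynomial case of Theorem 1.4 / Theorem 3.11.) Let φ ∈ O_L[X] be a polynomial of degree d ≥ 2 with good reduction. Then the fixed point locus Fix(φ) ⊆ A¹_an is a finite set if and only if every affine residually fixed point of φ̃ is critical, i.e. for every c ∈ k with φ̃(c) = c one has φ̃'(c) = 0. Moreover, in this case Fix(φ) consists exactly of the Gauss point together with the evaluation points at the classical fixed points: Fix(φ) = {ζ_G} ∪ {ev_a : a ∈ L, φ(a) = a}. -/

import Mathlib

open Polynomial

/-- A point of the Berkovich affine line `A¹_an` over `L`: a multiplicative ring seminorm
on `L[X]` whose restriction to the constant polynomials is the given absolute value of `L`. -/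
structure BerkovichPoint (L : Type*) [NontriviallyNormedField L] where
  toFun : Polynomial L → ℝ
  nonneg' : ∀ P, 0 ≤ toFun P
  map_mul' : ∀ P Q, toFun (P * Q) = toFun P * toFun Q
  add_le' : ∀ P Q, toFun (P + Q) ≤ toFun P + toFun Q
  const' : ∀ a : L, toFun (C a) = ‖a‖

namespace BerkovichPoint

variable {L : Type*} [NontriviallyNormedField L]

/-- The topology of pointwise convergence on the Berkovich affine line. -/
instance : TopologicalSpace (BerkovichPoint L) :=
  TopologicalSpace.induced (fun x => x.toFun) Pi.topologicalSpace

/-- The Gauss norm of a polynomial: the maximum of the absolute values of its coefficients.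
The Gauss point `ζ_G` is the point of the Berkovich affine line given by this seminorm. -/
noncomputable def gaussNorm (P : Polynomial L) : ℝ := ⨆ i : ℕ, ‖P.coeff i‖

/-- The type 1 (evaluation) point of the Berkovich affine line attached to `a ∈ L`:
`ev_a(P) = ‖P(a)‖`. -/
noncomputable def evPoint (a : L) : BerkovichPoint L where
  toFun P := ‖P.eval a‖
  nonneg' P := norm_nonneg _
  map_mul' P Q := by simp
  add_le' P Q := by simp only [eval_add]; exact norm_add_le _ _
  const' b := by simp

/-- The action of a polynomial `φ` on the Berkovich affine line by pushforward:
`(φ_* x)(P) = x(P ∘ φ)`.  The fixed point locus of `φ` is `{x | pushforward φ x = x}`. -/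
noncomputable def pushforward (φ : Polynomial L) (x : BerkovichPoint L) : BerkovichPoint L where
  toFun P := x.toFun (P.comp φ)
  nonneg' P := x.nonneg' _
  map_mul' P Q := by simp only [mul_comp]; exact x.map_mul' _ _
  add_le' P Q := by simp only [add_comp]; exact x.add_le' _ _
  const' a := by simp only [C_comp]; exact x.const' a

end BerkovichPoint

open BerkovichPoint

namespace BerkovichPoint

variable {L : Type*} [NontriviallyNormedField L]

@[ext]
theorem ext_toFun {x y : BerkovichPoint L} (h : ∀ P, x.toFun P = y.toFun P) : x = y := by
  cases x; cases y; congr; exact funext h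

section Basic

variable (x : BerkovichPoint L)

theorem map_zero : x.toFun 0 = 0 := by simpa using x.const' 0

theorem map_one : x.toFun 1 = 1 := by simpa using x.const' 1

theorem map_neg (P : L[X]) : x.toFun (-P) = x.toFun P := by
  have h := x.map_mul' (C (-1)) P
  rw [x.const'] at h
  simpa using h

theorem map_pow (P : L[X]) (n : ℕ) : x.toFun (P ^ n) = x.toFun P ^ n := by
  induction n with
  | zero => simpa using x.map_one
  | succ n ih => rw [pow_succ, x.map_mul', ih, pow_succ]

theorem map_sum_le {ι : Type*} (s : Finset ι) (f : ι → L[X]) :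
    x.toFun (∑ i ∈ s, f i) ≤ ∑ i ∈ s, x.toFun (f i) := by
  classical
  induction s using Finset.induction_on with
  | empty => simp [x.map_zero]
  | insert a s ha ih =>
    rw [Finset.sum_insert ha, Finset.sum_insert ha]
    exact (x.add_le' _ _).trans (by gcongr)

theorem map_multiset_prod (s : Multiset L[X]) :
    x.toFun s.prod = (s.map x.toFun).prod := by
  induction s using Multiset.induction_on with
  | empty => simpa using x.map_one
  | cons a s ih => simp [x.map_mul', ih]

end Basic

/-- A Berkovich point over an algebraically closed field is determined by its values on monic
linear polynomials. -/
theorem ext_linear [IsAlgClosed L] {x y : BerkovichPoint L}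
    (h : ∀ a : L, x.toFun (X - C a) = y.toFun (X - C a)) : x = y := by
  ext P
  rw [(IsAlgClosed.splits P).eq_prod_roots]
  simp only [map_mul', const', map_multiset_prod, Multiset.map_map, Function.comp_def, h]

theorem pushforward_evPoint (φ : L[X]) (a : L) :
    pushforward φ (evPoint a) = evPoint (φ.eval a) := by
  ext P
  simp [pushforward, evPoint, eval_comp]

theorem norm_sub_le_max (hna : IsNonarchimedean (fun x : L => ‖x‖)) (a b : L) :
    ‖a - b‖ ≤ max ‖a‖ ‖b‖ := by
  simpa [sub_eq_add_neg] using hna a (-b)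

theorem norm_natCast_le_one (hna : IsNonarchimedean (fun x : L => ‖x‖)) (n : ℕ) :
    ‖(n : L)‖ ≤ 1 := by
  induction n with
  | zero => simp
  | succ n ih =>
    push_cast
    exact (hna _ _).trans (max_le ih (by simp))

theorem isNonarchimedean (hna : IsNonarchimedean (fun x : L => ‖x‖)) (x : BerkovichPoint L) :
    IsNonarchimedean x.toFun := by
  intro P Q
  set M := max (x.toFun P) (x.toFun Q) with hM
  have hP : x.toFun P ≤ M := le_max_left _ _
  have hQ : x.toFun Q ≤ M := le_max_right _ _
  have hM0 : 0 ≤ M := (x.nonneg' P).trans hP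
  have key (m : ℕ) : x.toFun (P + Q) ^ m ≤ (m + 1 : ℝ) * M ^ m := by
    rw [← x.map_pow, add_pow]
    refine (x.map_sum_le _ _).trans ?_
    have hterm : ∀ i ∈ Finset.range (m + 1),
        x.toFun (P ^ i * Q ^ (m - i) * (m.choose i : L[X])) ≤ M ^ m := by
      intro i hi
      have hi' : i ≤ m := Nat.lt_succ_iff.mp (Finset.mem_range.mp hi)
      rw [x.map_mul', x.map_mul', x.map_pow, x.map_pow, ← C_eq_natCast, x.const']
      calc x.toFun P ^ i * x.toFun Q ^ (m - i) * ‖(m.choose i : L)‖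
          ≤ M ^ i * M ^ (m - i) * 1 := by
            have := x.nonneg' P
            have := x.nonneg' Q
            gcongr
            exact norm_natCast_le_one hna _
        _ = M ^ m := by rw [mul_one, ← pow_add, Nat.add_sub_cancel' hi']
    refine (Finset.sum_le_sum hterm).trans ?_
    simp
  rcases hM0.eq_or_lt with h0 | hpos
  · exact (x.add_le' P Q).trans (by linarith)
  refine le_of_forall_gt_imp_ge_of_dense fun a ha ↦ ?_
  obtain ⟨m, hm⟩ : ∃ m : ℕ, ((m + 1 : ℕ) : ℝ) < (a / M) ^ m := by
    apply_mod_cast Real.exists_natCast_add_one_lt_pow_of_one_lt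
    rwa [one_lt_div hpos]
  rw [div_pow, lt_div_iff₀ (by positivity)] at hm
  push_cast at hm
  have hlt := (key m).trans_lt hm
  exact (lt_of_pow_lt_pow_left₀ m (hpos.trans ha).le hlt).le

theorem map_sub_le_max (hna : IsNonarchimedean (fun x : L => ‖x‖)) (x : BerkovichPoint L)
    (P Q : L[X]) : x.toFun (P - Q) ≤ max (x.toFun P) (x.toFun Q) := by
  rw [sub_eq_add_neg, ← x.map_neg Q]
  exact x.isNonarchimedean hna _ _

theorem le_of_forall_coeff_le (hna : IsNonarchimedean (fun x : L => ‖x‖))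
    (x : BerkovichPoint L) {P : L[X]} {M : ℝ} (hM : 0 ≤ M)
    (h : ∀ i ∈ P.support, ‖P.coeff i‖ * x.toFun X ^ i ≤ M) : x.toFun P ≤ M := by
  have hsum : ∀ s : Finset ℕ, s ⊆ P.support → x.toFun (∑ i ∈ s, C (P.coeff i) * X ^ i) ≤ M := by
    intro s
    induction s using Finset.induction_on with
    | empty => intro _; simpa [x.map_zero] using hM
    | insert a s ha ih =>
      intro hs
      rw [Finset.sum_insert ha]
      refine (x.isNonarchimedean hna _ _).trans (max_le ?_ ?_)
      · rw [x.map_mul', x.const', x.map_pow]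
        exact h a (hs (Finset.mem_insert_self a s))
      · exact ih ((Finset.subset_insert a s).trans hs)
  rw [P.as_sum_support_C_mul_X_pow]
  exact hsum _ subset_rfl

theorem bddAbove_range_norm_coeff (P : L[X]) : BddAbove (Set.range fun i => ‖P.coeff i‖) := by
  refine ⟨∑ i ∈ P.support, ‖P.coeff i‖, ?_⟩
  rintro _ ⟨i, rfl⟩
  by_cases hi : i ∈ P.support
  · exact Finset.single_le_sum (f := fun i => ‖P.coeff i‖) (fun _ _ => norm_nonneg _) hi
  · simp only [notMem_support_iff.mp hi, norm_zero]
    positivity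

theorem norm_coeff_le_gaussNorm (P : L[X]) (i : ℕ) : ‖P.coeff i‖ ≤ gaussNorm P :=
  le_ciSup (bddAbove_range_norm_coeff P) i

theorem gaussNorm_le {P : L[X]} {M : ℝ} (h : ∀ i, ‖P.coeff i‖ ≤ M) : gaussNorm P ≤ M :=
  ciSup_le h

theorem gaussNorm_nonneg (P : L[X]) : 0 ≤ gaussNorm P :=
  (norm_nonneg _).trans (norm_coeff_le_gaussNorm P 0)

theorem gaussNorm_C_add_X_mul (u : L) (P : L[X]) :
    gaussNorm (C u + X * P) = max ‖u‖ (gaussNorm P) := by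
  apply le_antisymm
  · refine gaussNorm_le fun i => ?_
    cases i with
    | zero => simp
    | succ i =>
      simp only [coeff_add, coeff_C_succ, coeff_X_mul, zero_add]
      exact le_max_of_le_right (norm_coeff_le_gaussNorm P i)
  · refine max_le ?_ (gaussNorm_le fun i => ?_)
    · have := norm_coeff_le_gaussNorm (C u + X * P) 0
      rwa [coeff_add, coeff_C_zero, mul_coeff_zero, coeff_X_zero, zero_mul, add_zero] at this
    · have := norm_coeff_le_gaussNorm (C u + X * P) (i + 1)
      rwa [coeff_add, coeff_C_succ, coeff_X_mul, zero_add] at this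

theorem gaussNorm_C_add_X_mul_C (u t : L) : gaussNorm (C u + X * C t) = max ‖u‖ ‖t‖ := by
  have h : gaussNorm (C t) = ‖t‖ := by
    have h0 : gaussNorm (0 : L[X]) = 0 := by simp [gaussNorm]
    have := gaussNorm_C_add_X_mul t 0
    simpa [h0] using this
  rw [gaussNorm_C_add_X_mul, h]

theorem gaussNorm_X_sub_C (a : L) : gaussNorm (X - C a) = max ‖a‖ 1 := by
  have := gaussNorm_C_add_X_mul_C (-a) 1
  rw [norm_neg, norm_one] at this
  rw [← this]
  congr 1
  simp only [C_neg, C_1]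
  ring

/-- A Berkovich point in the closed unit disc is dominated by the Gauss norm. -/
theorem le_gaussNorm (hna : IsNonarchimedean (fun x : L => ‖x‖)) (x : BerkovichPoint L)
    (hx : x.toFun X ≤ 1) (P : L[X]) : x.toFun P ≤ gaussNorm P := by
  refine x.le_of_forall_coeff_le hna (gaussNorm_nonneg P) fun i _ => ?_
  calc ‖P.coeff i‖ * x.toFun X ^ i ≤ ‖P.coeff i‖ * 1 := by
        gcongr
        exact pow_le_one₀ (x.nonneg' X) hx
    _ ≤ gaussNorm P := by rw [mul_one]; exact norm_coeff_le_gaussNorm P i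

theorem norm_eval_le_gaussNorm (hna : IsNonarchimedean (fun x : L => ‖x‖)) {a : L}
    (ha : ‖a‖ ≤ 1) (P : L[X]) : ‖P.eval a‖ ≤ gaussNorm P :=
  (evPoint a).le_gaussNorm hna (by simpa [evPoint] using ha) P

/-- A polynomial with integral coefficients can be divided by `X - a`, for `a` integral, with an
integral quotient. -/
theorem exists_eq_C_add_X_sub_C_mul (hna : IsNonarchimedean (fun x : L => ‖x‖))
    {ζG : BerkovichPoint L} (hζG : ∀ P : L[X], ζG.toFun P = gaussNorm P)
    {P : L[X]} (hP : gaussNorm P ≤ 1) {a : L} (ha : ‖a‖ ≤ 1) :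
    ∃ Q : L[X], gaussNorm Q ≤ 1 ∧ P = C (P.eval a) + (X - C a) * Q := by
  obtain ⟨Q, hQ⟩ := X_sub_C_dvd_sub_C_eval (p := P) (a := a)
  refine ⟨Q, ?_, by rw [← hQ]; ring⟩
  have h := ζG.map_mul' (X - C a) Q
  rw [← hQ, hζG (X - C a), gaussNorm_X_sub_C, max_eq_right ha, one_mul] at h
  rw [← hζG, ← h]
  refine (map_sub_le_max hna ζG _ _).trans (max_le (by rwa [hζG]) ?_)
  rw [ζG.const']
  exact (norm_eval_le_gaussNorm hna ha P).trans hP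

theorem gaussNorm_derivative_le_one (hna : IsNonarchimedean (fun x : L => ‖x‖)) {P : L[X]}
    (hP : gaussNorm P ≤ 1) : gaussNorm (derivative P) ≤ 1 := by
  refine gaussNorm_le fun i => ?_
  rw [coeff_derivative, norm_mul]
  have h := norm_natCast_le_one hna (i + 1)
  push_cast at h
  exact mul_le_one₀ ((norm_coeff_le_gaussNorm P _).trans hP) (norm_nonneg _) h

/-- Second order Taylor expansion of a polynomial with integral coefficients. -/
theorem exists_taylor_two (hna : IsNonarchimedean (fun x : L => ‖x‖))
    {ζG : BerkovichPoint L} (hζG : ∀ P : L[X], ζG.toFun P = gaussNorm P)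
    {P : L[X]} (hP : gaussNorm P ≤ 1) {a : L} (ha : ‖a‖ ≤ 1) :
    ∃ H : L[X], gaussNorm H ≤ 1 ∧
      P = C (P.eval a) + (X - C a) * (C ((derivative P).eval a) + (X - C a) * H) := by
  obtain ⟨Q, hQ1, hQ⟩ := exists_eq_C_add_X_sub_C_mul hna hζG hP ha
  obtain ⟨H, hH1, hH⟩ := exists_eq_C_add_X_sub_C_mul hna hζG hQ1 ha
  refine ⟨H, hH1, ?_⟩
  have hd : (derivative P).eval a = Q.eval a := by
    rw [hQ]
    simp
  rw [hd, ← hH]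
  exact hQ

theorem exists_root_norm_sub_lt_one [IsAlgClosed L] {P : L[X]} (hP : ‖P.leadingCoeff‖ = 1) {c : L}
    (hc : ‖P.eval c‖ < 1) : ∃ a, P.eval a = 0 ∧ ‖c - a‖ < 1 := by
  by_contra! h
  have hP0 : P ≠ 0 := by rintro rfl; simp at hP
  have hprod : ∀ s : Multiset L, (∀ a ∈ s, 1 ≤ ‖c - a‖) → 1 ≤ ‖(s.map fun a => c - a).prod‖ := by
    intro s
    induction s using Multiset.induction_on with
    | empty => simp
    | cons a s ih =>
      intro hs
      rw [Multiset.map_cons, Multiset.prod_cons, norm_mul]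
      exact one_le_mul_of_one_le_of_one_le (hs a (Multiset.mem_cons_self a s))
        (ih fun b hb => hs b (Multiset.mem_cons_of_mem hb))
  have := hprod P.roots fun a ha => h a ((mem_roots hP0).mp ha)
  rw [(IsAlgClosed.splits P).eval_eq_prod_roots, norm_mul, hP, one_mul] at hc
  linarith

/-- A point of the affine line fixed by a polynomial of good reduction lies in the closed unit
disc. -/
theorem toFun_X_le_one_of_pushforward_eq (hna : IsNonarchimedean (fun x : L => ‖x‖))
    {φ : L[X]} (hd : 2 ≤ φ.natDegree) (hcoeff : ∀ i, ‖φ.coeff i‖ ≤ 1)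
    (hlead : ‖φ.leadingCoeff‖ = 1) {x : BerkovichPoint L} (hx : pushforward φ x = x) :
    x.toFun X ≤ 1 := by
  by_contra! hr
  have hfix : x.toFun φ = x.toFun X := by
    have := congrArg (fun z : BerkovichPoint L => z.toFun X) hx
    simpa [pushforward] using this
  set r := x.toFun X with hrdef
  have hr0 : 0 ≤ r := by linarith
  have hlow : x.toFun φ.eraseLead ≤ r ^ (φ.natDegree - 1) := by
    refine x.le_of_forall_coeff_le hna (by positivity) fun i hi => ?_
    have hi' : i < φ.natDegree := lt_natDegree_of_mem_eraseLead_support hi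
    rw [eraseLead_coeff_of_ne i hi'.ne]
    calc ‖φ.coeff i‖ * r ^ i ≤ 1 * r ^ (φ.natDegree - 1) := by
          gcongr
          · exact hcoeff i
          · exact hr.le
          · omega
      _ = _ := one_mul _
  have htop : x.toFun (φ - φ.eraseLead) = r ^ φ.natDegree := by
    rw [sub_eq_of_eq_add' φ.eraseLead_add_C_mul_X_pow.symm, x.map_mul', x.const', hlead, one_mul,
      x.map_pow]
  have hle := map_sub_le_max hna x φ φ.eraseLead
  rw [htop, hfix] at hle
  have h1 : r < r ^ φ.natDegree := lt_self_pow₀ hr (by omega)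
  have h2 : r ^ (φ.natDegree - 1) < r ^ φ.natDegree := pow_lt_pow_right₀ hr (by omega)
  have := hle.trans (max_le_max le_rfl hlow)
  rcases le_max_iff.mp this with h | h <;> linarith

theorem eq_gaussPoint [IsAlgClosed L] (hna : IsNonarchimedean (fun x : L => ‖x‖))
    {ζG : BerkovichPoint L} (hζG : ∀ P : L[X], ζG.toFun P = gaussNorm P)
    {x : BerkovichPoint L} (hx : x.toFun X ≤ 1)
    (h : ∀ c : L, ‖c‖ ≤ 1 → 1 ≤ x.toFun (X - C c)) : x = ζG := by
  refine ext_linear fun a => le_antisymm ?_ ?_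
  · rw [hζG]
    exact x.le_gaussNorm hna hx _
  rw [hζG, gaussNorm_X_sub_C]
  rcases le_or_gt ‖a‖ 1 with ha | ha
  · rw [max_eq_right ha]
    exact h a ha
  · rw [max_eq_left ha.le]
    have := map_sub_le_max hna x X (X - C a)
    rw [sub_sub_cancel, x.const'] at this
    rcases le_max_iff.mp this with h' | h'
    · linarith
    · exact h'

theorem eq_evPoint [IsAlgClosed L] (hna : IsNonarchimedean (fun x : L => ‖x‖))
    {x : BerkovichPoint L} {a : L} (h : x.toFun (X - C a) = 0) : x = evPoint a := by
  refine ext_linear fun b => ?_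
  have hev : (evPoint a).toFun (X - C b) = x.toFun (C (a - b)) := by
    rw [x.const']
    simp [evPoint]
  rw [hev]
  apply le_antisymm
  · have := x.isNonarchimedean hna (X - C a) (C (a - b))
    rw [h, max_eq_right (x.nonneg' _)] at this
    simpa using this
  · have := map_sub_le_max hna x (X - C b) (X - C a)
    rw [h, max_eq_left (x.nonneg' _)] at this
    simpa using this

theorem pushforward_gaussPoint [IsAlgClosed L] (hna : IsNonarchimedean (fun x : L => ‖x‖))
    {ζG : BerkovichPoint L} (hζG : ∀ P : L[X], ζG.toFun P = gaussNorm P)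
    {φ : L[X]} (hd : 1 ≤ φ.natDegree) (hcoeff : ∀ i, ‖φ.coeff i‖ ≤ 1)
    (hlead : ‖φ.leadingCoeff‖ = 1) : pushforward φ ζG = ζG := by
  refine ext_linear fun b => ?_
  have hdiv : gaussNorm φ.divX = 1 := by
    refine le_antisymm (gaussNorm_le fun i => by rw [coeff_divX]; exact hcoeff _) ?_
    have := norm_coeff_le_gaussNorm φ.divX (φ.natDegree - 1)
    rwa [coeff_divX, Nat.sub_add_cancel hd, coeff_natDegree, hlead] at this
  have hφ : (X - C b).comp φ = C (φ.coeff 0 - b) + X * φ.divX := by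
    conv_lhs => rw [← divX_mul_X_add φ]
    simp only [sub_comp, X_comp, C_comp, C_sub]
    ring
  change ζG.toFun ((X - C b).comp φ) = _
  rw [hφ, hζG, hζG, gaussNorm_C_add_X_mul, hdiv, gaussNorm_X_sub_C]
  have h0 := hcoeff 0
  apply le_antisymm
  · refine max_le ?_ (le_max_right _ _)
    exact (norm_sub_le_max hna _ _).trans (max_le (le_max_of_le_right h0) (le_max_left _ _))
  · refine max_le ?_ (le_max_right _ _)
    have := norm_sub_le_max hna (φ.coeff 0) (φ.coeff 0 - b)
    rw [sub_sub_cancel] at this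
    exact this.trans (max_le (le_max_of_le_right h0) (le_max_left _ _))

theorem leadingCoeff_sub_X {φ : L[X]} (hd : 2 ≤ φ.natDegree) :
    (φ - X).leadingCoeff = φ.leadingCoeff := by
  apply leadingCoeff_sub_of_degree_lt
  rw [degree_X]
  rw [degree_eq_natDegree (by rintro rfl; simp at hd)]
  exact_mod_cast hd

/-- If every fixed residue class of `φ` is critical, a fixed point is either the Gauss point or
a classical fixed point. -/
theorem eq_gaussPoint_or_evPoint [IsAlgClosed L] (hna : IsNonarchimedean (fun x : L => ‖x‖))
    {ζG : BerkovichPoint L} (hζG : ∀ P : L[X], ζG.toFun P = gaussNorm P)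
    {φ : L[X]} (hd : 2 ≤ φ.natDegree) (hcoeff : ∀ i, ‖φ.coeff i‖ ≤ 1)
    (hlead : ‖φ.leadingCoeff‖ = 1)
    (hcrit : ∀ c : L, ‖c‖ ≤ 1 → ‖φ.eval c - c‖ < 1 → ‖(derivative φ).eval c‖ < 1)
    {x : BerkovichPoint L} (hx : pushforward φ x = x) :
    x = ζG ∨ ∃ a, φ.eval a = a ∧ evPoint a = x := by
  have hφ1 : gaussNorm φ ≤ 1 := gaussNorm_le hcoeff
  have hX := toFun_X_le_one_of_pushforward_eq hna hd hcoeff hlead hx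
  have hfix (b : L) : x.toFun (φ - C b) = x.toFun (X - C b) := by
    have := congrArg (fun z : BerkovichPoint L => z.toFun (X - C b)) hx
    simpa [pushforward] using this
  by_cases h : ∀ c : L, ‖c‖ ≤ 1 → 1 ≤ x.toFun (X - C c)
  · exact Or.inl (eq_gaussPoint hna hζG hX h)
  push Not at h
  obtain ⟨c, hc1, hc⟩ := h
  refine Or.inr ?_
  obtain ⟨Q, hQ1, hQ⟩ := exists_eq_C_add_X_sub_C_mul hna hζG hφ1 hc1
  have hφc : x.toFun (X - C (φ.eval c)) < 1 := by
    rw [← hfix]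
    have : φ - C (φ.eval c) = (X - C c) * Q := sub_eq_of_eq_add' hQ
    rw [this, x.map_mul']
    exact mul_lt_one_of_nonneg_of_lt_one_left (x.nonneg' _) hc
      ((x.le_gaussNorm hna hX Q).trans hQ1)
  have hres : ‖(φ - X).eval c‖ < 1 := by
    have := map_sub_le_max hna x (X - C c) (X - C (φ.eval c))
    rw [sub_sub_sub_cancel_left, ← C_sub, x.const'] at this
    simpa using this.trans_lt (max_lt hc hφc)
  obtain ⟨a, ha, hca⟩ := exists_root_norm_sub_lt_one (by rwa [leadingCoeff_sub_X hd]) hres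
  have hfa : φ.eval a = a := by simpa [sub_eq_zero] using ha
  have ha1 : ‖a‖ ≤ 1 := by
    have := norm_sub_le_max hna c (c - a)
    rw [sub_sub_cancel] at this
    exact this.trans (max_le hc1 hca.le)
  have hxa : x.toFun (X - C a) < 1 := by
    have := x.isNonarchimedean hna (X - C c) (C (c - a))
    rw [x.const', C_sub, sub_add_sub_cancel] at this
    exact this.trans_lt (max_lt hc hca)
  refine ⟨a, hfa, (eq_evPoint hna ?_).symm⟩
  obtain ⟨H, hH1, hH⟩ := exists_taylor_two hna hζG hφ1 ha1
  set G := C ((derivative φ).eval a) + (X - C a) * H with hG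
  have hG1 : x.toFun G < 1 := by
    refine (x.isNonarchimedean hna _ _).trans_lt (max_lt ?_ ?_)
    · rw [x.const']
      exact hcrit a ha1 (by simp [hfa])
    · rw [x.map_mul']
      exact mul_lt_one_of_nonneg_of_lt_one_left (x.nonneg' _) hxa
        ((x.le_gaussNorm hna hX H).trans hH1)
  have hmul : x.toFun (X - C a) = x.toFun (X - C a) * x.toFun G := by
    rw [← x.map_mul', ← hfix]
    congr 1
    rw [hfa] at hH
    exact sub_eq_of_eq_add' hH
  by_contra hne
  have := mul_left_cancel₀ hne ((mul_one _).trans hmul)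
  linarith

/-- If `a` is an indifferent fixed point of `φ`, the maximum norm on each closed disc around `a`
of radius `‖t‖ < 1` is fixed by `φ`. -/
theorem pushforward_disc [IsAlgClosed L] (hna : IsNonarchimedean (fun x : L => ‖x‖))
    {ζG : BerkovichPoint L} (hζG : ∀ P : L[X], ζG.toFun P = gaussNorm P)
    {φ : L[X]} (hcoeff : ∀ i, ‖φ.coeff i‖ ≤ 1) {a : L} (ha1 : ‖a‖ ≤ 1) (hfa : φ.eval a = a)
    (hda : ‖(derivative φ).eval a‖ = 1) {t : L} (ht : ‖t‖ < 1) :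
    pushforward φ (pushforward (C a + X * C t) ζG) = pushforward (C a + X * C t) ζG := by
  obtain ⟨H, hH1, hH⟩ := exists_taylor_two hna hζG (gaussNorm_le hcoeff) ha1
  rw [hfa] at hH
  set ψ := C a + X * C t with hψ
  have hHψ : gaussNorm (H.comp ψ) ≤ 1 := by
    rw [← hζG]
    refine ((pushforward ψ ζG).le_gaussNorm hna ?_ H).trans hH1
    change ζG.toFun (X.comp ψ) ≤ 1
    rw [X_comp, hζG, gaussNorm_C_add_X_mul_C]
    exact max_le ha1 ht.le
  have hmulC (P : L[X]) : gaussNorm (C t * P) = ‖t‖ * gaussNorm P := by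
    rw [← hζG, ζG.map_mul', ζG.const', hζG]
  refine ext_linear fun b => ?_
  have hlhs : ((X - C b).comp φ).comp ψ = C (a - b) +
      X * (C t * (C ((derivative φ).eval a) + X * (C t * H.comp ψ))) := by
    conv_lhs => rw [hH]
    simp only [sub_comp, add_comp, mul_comp, X_comp, C_comp, hψ, C_sub]
    ring
  have hrhs : (X - C b).comp ψ = C (a - b) + X * C t := by
    simp only [sub_comp, X_comp, C_comp, hψ, C_sub]
    ring
  change ζG.toFun (((X - C b).comp φ).comp ψ) = ζG.toFun ((X - C b).comp ψ)
  rw [hlhs, hrhs, hζG, hζG, gaussNorm_C_add_X_mul_C, gaussNorm_C_add_X_mul, hmulC,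
    gaussNorm_C_add_X_mul, hmulC, hda, max_eq_left (mul_le_one₀ ht.le (gaussNorm_nonneg _) hHψ), mul_one]

/-- A noncritical fixed residue class of `φ` produces infinitely many fixed points. -/
theorem infinite_fixed [IsAlgClosed L] (hna : IsNonarchimedean (fun x : L => ‖x‖))
    {ζG : BerkovichPoint L} (hζG : ∀ P : L[X], ζG.toFun P = gaussNorm P)
    {φ : L[X]} (hd : 2 ≤ φ.natDegree) (hcoeff : ∀ i, ‖φ.coeff i‖ ≤ 1)
    (hlead : ‖φ.leadingCoeff‖ = 1) {c : L} (hc1 : ‖c‖ ≤ 1) (hc : ‖φ.eval c - c‖ < 1)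
    (hdc : 1 ≤ ‖(derivative φ).eval c‖) :
    {x : BerkovichPoint L | pushforward φ x = x}.Infinite := by
  obtain ⟨a, ha, hca⟩ := exists_root_norm_sub_lt_one (P := φ - X) (c := c)
    (by rwa [leadingCoeff_sub_X hd]) (by simpa using hc)
  have hfa : φ.eval a = a := by simpa [sub_eq_zero] using ha
  have ha1 : ‖a‖ ≤ 1 := by
    have := norm_sub_le_max hna c (c - a)
    rw [sub_sub_cancel] at this
    exact this.trans (max_le hc1 hca.le)
  have hφ' := gaussNorm_derivative_le_one hna (gaussNorm_le hcoeff)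
  have hda : ‖(derivative φ).eval a‖ = 1 := by
    refine le_antisymm ((norm_eval_le_gaussNorm hna ha1 _).trans hφ') ?_
    by_contra! hlt
    obtain ⟨Q, hQ1, hQ⟩ := exists_eq_C_add_X_sub_C_mul hna hζG hφ' ha1
    have heq : (derivative φ).eval c = (derivative φ).eval a + (c - a) * Q.eval c := by
      have := congrArg (eval c) hQ
      simpa using this
    have hmul : ‖(c - a) * Q.eval c‖ < 1 := by
      rw [norm_mul]
      exact mul_lt_one_of_nonneg_of_lt_one_left (norm_nonneg _) hca
        ((norm_eval_le_gaussNorm hna hc1 Q).trans hQ1)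
    rw [heq] at hdc
    exact absurd ((hna _ _).trans_lt (max_lt hlt hmul)) (not_lt.mpr hdc)
  obtain ⟨t, ht0, ht1⟩ := NormedField.exists_norm_lt_one L
  refine Set.infinite_of_injective_forall_mem
    (f := fun n : ℕ => pushforward (C a + X * C (t ^ (n + 1))) ζG) ?_ fun n =>
      pushforward_disc hna hζG hcoeff ha1 hfa hda
        (by rw [norm_pow]; exact pow_lt_one₀ ht0.le ht1 (by omega))
  have hval (n : ℕ) : (pushforward (C a + X * C (t ^ (n + 1))) ζG).toFun (X - C a) =
      ‖t‖ ^ (n + 1) := by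
    change ζG.toFun ((X - C a).comp _) = _
    have := gaussNorm_C_add_X_mul_C 0 (t ^ (n + 1))
    rw [hζG]
    simpa using this
  intro m n hmn
  have := congrArg (fun z : BerkovichPoint L => z.toFun (X - C a)) hmn
  simp only [hval] at this
  have := pow_right_injective₀ ht0 ht1.ne this
  omega

end BerkovichPoint

/-- Polynomial case of Theorem 1.4 / Theorem 3.11: for a polynomial `φ ∈ O_L[X]` of degree
`d ≥ 2` with good reduction, the fixed point locus `Fix(φ) ⊆ A¹_an` is finite if and only
if every affine residually fixed point of `φ̃` is critical (i.e. every `c ∈ O_L` with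
`‖φ(c) − c‖ < 1` satisfies `‖φ'(c)‖ < 1`); and in that case `Fix(φ)` consists exactly of
the Gauss point together with the evaluation points at the classical fixed points of `φ`. -/
theorem fixed_locus_finite_iff_every_fixed_direction_critical
    (L : Type*) [NontriviallyNormedField L] [CompleteSpace L] [IsAlgClosed L] [CharZero L]
    (hna : IsNonarchimedean (fun x : L => ‖x‖))
    (φ : L[X]) (d : ℕ) (hd : 2 ≤ d) (hdeg : φ.natDegree = d)
    (hcoeff : ∀ i, ‖φ.coeff i‖ ≤ 1) (hlead : ‖φ.leadingCoeff‖ = 1)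
    (ζG : BerkovichPoint L) (hζG : ∀ P : L[X], ζG.toFun P = gaussNorm P) :
    ({x : BerkovichPoint L | pushforward φ x = x}.Finite ↔
      ∀ c : L, ‖c‖ ≤ 1 → ‖φ.eval c - c‖ < 1 → ‖(derivative φ).eval c‖ < 1) ∧
    ((∀ c : L, ‖c‖ ≤ 1 → ‖φ.eval c - c‖ < 1 → ‖(derivative φ).eval c‖ < 1) →
      {x : BerkovichPoint L | pushforward φ x = x} =
        insert ζG (evPoint '' {a : L | φ.eval a = a})) := by
  subst hdeg
  have heq (hcrit : ∀ c : L, ‖c‖ ≤ 1 → ‖φ.eval c - c‖ < 1 → ‖(derivative φ).eval c‖ < 1) :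
      {x : BerkovichPoint L | pushforward φ x = x} =
        insert ζG (evPoint '' {a : L | φ.eval a = a}) := by
    ext x
    refine ⟨eq_gaussPoint_or_evPoint hna hζG hd hcoeff hlead hcrit, ?_⟩
    rintro (rfl | ⟨a, ha, rfl⟩)
    · exact pushforward_gaussPoint hna hζG (by omega) hcoeff hlead
    · exact (pushforward_evPoint φ a).trans (congrArg evPoint ha)
  refine ⟨⟨fun hfin c hc1 hc => ?_, fun hcrit => ?_⟩, heq⟩
  · by_contra! hdc
    exact infinite_fixed hna hζG hd hcoeff hlead hc1 hc hdc hfin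
  · rw [heq hcrit]
    have hne : φ - X ≠ 0 := by
      rw [← leadingCoeff_ne_zero, leadingCoeff_sub_X hd, ← norm_ne_zero_iff, hlead]
      exact one_ne_zero
    refine (Set.Finite.image _ ((finite_setOfPred_isRoot hne).subset fun a ha => ?_)).insert _
    simpa [sub_eq_zero] using ha
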